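/- For every n ≥ 5, there exists a prime s > 19 such that s divides 13^n - 1 and s does not divide 13^i - 1 for any 1 ≤ i < n. -/

import Mathlib

open Polynomial in
/-- A prime dividing `Φₙ(a)` that is not a primitive divisor of `aⁿ - 1` divides `n`, and the
`p`-free part of `n` is the order of `a` modulo `p`. -/
theorem exists_eq_pow_mul_orderOf_of_dvd_cyclotomic_eval {a n p : ℕ} [hp : Fact p.Prime]
    (hn : n ≠ 0) (h : (p : ℤ) ∣ (cyclotomic n ℤ).eval (a : ℤ)) :
    ∃ k : ℕ, n = p ^ k * orderOf (a : ZMod p) := by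
  obtain ⟨k, m, hpm, rfl⟩ := Nat.exists_eq_pow_mul_and_not_dvd hn p hp.out.ne_one
  have : NeZero (m : ZMod p) := NeZero.of_not_dvd (ZMod p) hpm
  have hroot : (cyclotomic (p ^ k * m) (ZMod p)).IsRoot (a : ZMod p) := by
    have h' := (ZMod.intCast_zmod_eq_zero_iff_dvd _ p).2 h
    rw [IsRoot.def, ← map_cyclotomic_int, eval_map]
    have h2 := hom_eval₂ (cyclotomic (p ^ k * m) ℤ) (RingHom.id ℤ) (Int.castRingHom (ZMod p))
      (a : ℤ)
    simp only [RingHom.comp_id, eq_intCast, Int.cast_natCast] at h2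
    rw [← h2]
    exact h'
  exact ⟨k, by rw [← (isRoot_cyclotomic_prime_pow_mul_iff_of_charP.1 hroot).eq_orderOf]⟩

theorem orderOf_natCast_zmod_lt {a p : ℕ} [hp : Fact p.Prime] : orderOf (a : ZMod p) < p := by
  by_cases h : (a : ZMod p) = 0
  · rw [h, orderOf_eq_zero_iff'.2]
    · exact hp.out.pos
    · intro n hn
      simp [hn.ne']
  · exact (Nat.le_of_dvd (Nat.sub_pos_of_lt hp.out.one_lt)
      (ZMod.orderOf_dvd_card_sub_one h)).trans_lt (Nat.sub_lt hp.out.pos one_pos)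

/-- If `y ≡ 1` modulo an odd prime `p`, then `p` divides `1 + y + ⋯ + y ^ (p - 1)` at most once. -/
theorem sq_not_dvd_geom_sum_of_dvd_sub_one {p : ℕ} (hp : p.Prime) (hodd : Odd p) {y : ℤ}
    (hy : (p : ℤ) ∣ y - 1) : ¬ (p : ℤ) ^ 2 ∣ ∑ i ∈ Finset.range p, y ^ i := by
  obtain ⟨b, hb⟩ := hy
  obtain rfl : y = 1 + p * b := by linarith
  have h := odd_sq_dvd_geom_sum₂_sub (a := (1 : ℤ)) (b := b) hodd
  simp only [one_pow, mul_one] at h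
  intro h'
  have h2 : (p : ℤ) ^ 2 ∣ p := (dvd_sub_right h').1 h
  have h3 : p ^ 2 ∣ p := by exact_mod_cast h2
  have := Nat.le_of_dvd hp.pos h3
  nlinarith [hp.two_le]

open Polynomial in
theorem cyclotomic_eval_dvd_geom_sum {a n p : ℕ} (ha : 2 ≤ a) (hn : n ≠ 0) (hp : p.Prime)
    (hpn : p ∣ n) :
    (cyclotomic n ℤ).eval (a : ℤ) ∣ ∑ i ∈ Finset.range p, ((a : ℤ) ^ (n / p)) ^ i := by
  have hd : n / p ∈ n.properDivisors :=
    Nat.mem_properDivisors.2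
      ⟨Nat.div_dvd_of_dvd hpn, Nat.div_lt_self (Nat.pos_of_ne_zero hn) hp.one_lt⟩
  have h := eval_dvd (x := (a : ℤ)) (X_pow_sub_one_mul_cyclotomic_dvd_X_pow_sub_one_of_dvd ℤ hd)
  simp only [eval_mul, eval_sub, eval_pow, eval_X, eval_one] at h
  have hne : (a : ℤ) ^ (n / p) - 1 ≠ 0 := by
    have : 1 < (a : ℤ) ^ (n / p) :=
      one_lt_pow₀ (by exact_mod_cast ha) (Nat.div_pos (Nat.le_of_dvd
        (Nat.pos_of_ne_zero hn) hpn) hp.pos).ne'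
    omega
  have hgeom := mul_geom_sum ((a : ℤ) ^ (n / p)) p
  rw [← pow_mul, Nat.div_mul_cancel hpn] at hgeom
  rw [← hgeom] at h
  exact (mul_dvd_mul_iff_left hne).1 h

open Polynomial in
theorem sq_not_dvd_cyclotomic_eval {a n p : ℕ} [hp : Fact p.Prime] (ha : 2 ≤ a) (hn : 3 ≤ n)
    (hpn : p ∣ n) : ¬ (p : ℤ) ^ 2 ∣ (cyclotomic n ℤ).eval (a : ℤ) := by
  intro h
  have hn0 : n ≠ 0 := by omega
  obtain ⟨k, hk⟩ := exists_eq_pow_mul_orderOf_of_dvd_cyclotomic_eval hn0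
    ((dvd_pow_self (p : ℤ) two_ne_zero).trans h)
  have hk0 : k ≠ 0 := by
    rintro rfl
    rw [pow_zero, one_mul] at hk
    have := Nat.le_of_dvd (Nat.pos_of_ne_zero hn0) hpn
    have := orderOf_natCast_zmod_lt (a := a) (p := p)
    omega
  obtain ⟨k, rfl⟩ := Nat.exists_eq_succ_of_ne_zero hk0
  have hdiv : n / p = p ^ k * orderOf (a : ZMod p) := by
    apply Nat.div_eq_of_eq_mul_right hp.out.pos
    rw [← mul_assoc, ← pow_succ']
    exact hk
  have hy : (p : ℤ) ∣ (a : ℤ) ^ (n / p) - 1 := by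
    rw [← ZMod.intCast_zmod_eq_zero_iff_dvd]
    push_cast
    rw [hdiv, mul_comm, pow_mul, pow_orderOf_eq_one, one_pow, sub_self]
  have hsum := h.trans (cyclotomic_eval_dvd_geom_sum ha hn0 hp.out hpn)
  rcases hp.out.eq_two_or_odd' with rfl | hodd
  · have ho : orderOf (a : ZMod 2) = 1 := by
      have := orderOf_natCast_zmod_lt (a := a) (p := 2)
      have : orderOf (a : ZMod 2) ≠ 0 := fun h0 => hn0 (by rw [hk, h0, mul_zero])
      omega
    rw [ho, mul_one] at hdiv hk
    have hk1 : k ≠ 0 := by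
      rintro rfl
      omega
    obtain ⟨j, rfl⟩ := Nat.exists_eq_succ_of_ne_zero hk1
    rw [hdiv, pow_succ 2 j, pow_mul] at hy hsum
    obtain ⟨c, hc⟩ : Odd ((a : ℤ) ^ 2 ^ j) := by
      have h1 : Odd (((a : ℤ) ^ 2 ^ j) ^ 2) := by
        rw [← Int.not_even_iff_odd, even_iff_two_dvd]
        push_cast at hy
        omega
      exact (Int.odd_pow' two_ne_zero).1 h1
    rw [hc] at hsum
    simp only [Finset.sum_range_succ, Finset.sum_range_zero] at hsum
    ring_nf at hsum
    omega
  · exact sq_not_dvd_geom_sum_of_dvd_sub_one hp.out hodd hy hsum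

open Polynomial in
/-- Zsigmondy's theorem for bases at least `3` and exponents at least `3`. -/
theorem exists_prime_orderOf_eq {a n : ℕ} (ha : 3 ≤ a) (hn : 3 ≤ n) :
    ∃ p : ℕ, p.Prime ∧ orderOf (a : ZMod p) = n := by
  by_contra! hno
  have hn0 : n ≠ 0 := by omega
  set N := ((cyclotomic n ℤ).eval (a : ℤ)).natAbs
  have hlt : (a - 1) ^ n.totient < N :=
    sub_one_pow_totient_lt_natAbs_cyclotomic_eval (by omega) (by omega)
  have key : ∀ p : ℕ, p.Prime → p ∣ N → p ∣ n ∧ ∃ k, n = p ^ k * orderOf (a : ZMod p) := by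
    intro p hp hpN
    have : Fact p.Prime := ⟨hp⟩
    obtain ⟨k, hk⟩ := exists_eq_pow_mul_orderOf_of_dvd_cyclotomic_eval hn0
      (Int.natCast_dvd.2 hpN)
    refine ⟨?_, k, hk⟩
    have hk0 : k ≠ 0 := by
      rintro rfl
      exact hno p hp (by simpa using hk.symm)
    rw [hk]
    exact (dvd_pow_self p hk0).mul_right _
  have le_of_dvd : ∀ p q : ℕ, p.Prime → q.Prime → p ∣ N → q ∣ N → q ≤ p := by
    intro p q hp hq hpN hqN
    have : Fact p.Prime := ⟨hp⟩
    obtain ⟨-, k, hk⟩ := key p hp hpN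
    have hqn := (key q hq hqN).1
    rw [hk] at hqn
    rcases hq.dvd_mul.1 hqn with h | h
    · exact Nat.le_of_dvd hp.pos (hq.dvd_of_dvd_pow h)
    · have ho : orderOf (a : ZMod p) ≠ 0 := fun h0 => hn0 (by rw [hk, h0, mul_zero])
      exact (Nat.le_of_dvd (Nat.pos_of_ne_zero ho) h).trans orderOf_natCast_zmod_lt.le
  have hN1 : 1 < N := lt_of_le_of_lt (Nat.one_le_pow _ _ (by omega)) hlt
  obtain ⟨p, hp, hpN⟩ := Nat.exists_prime_and_dvd hN1.ne'
  have : Fact p.Prime := ⟨hp⟩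
  have hpn := (key p hp hpN).1
  have hpow := Nat.eq_prime_pow_of_unique_prime_dvd (n := N) (p := p) (by omega)
    fun {q} hq hqN => le_antisymm (le_of_dvd p q hp hq hpN hqN) (le_of_dvd q p hq hp hqN hpN)
  have hle : N ≤ p := by
    by_contra! hlt'
    have h2 : 2 ≤ N.primeFactorsList.length := by
      by_contra! h1
      have : N ≤ p ^ 1 := hpow.le.trans (Nat.pow_le_pow_right hp.pos (by omega))
      exact hlt'.not_ge (by simpa using this)
    have hsq : p ^ 2 ∣ N := (pow_dvd_pow p h2).trans hpow.symm.dvd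
    refine sq_not_dvd_cyclotomic_eval (p := p) (by omega) hn hpn (a := a) ?_
    exact_mod_cast Int.natCast_dvd.2 hsq
  have htot : p - 1 ≤ n.totient := by
    rw [← Nat.totient_prime hp]
    exact Nat.le_of_dvd (Nat.totient_pos.2 (by omega)) (Nat.totient_dvd_of_dvd hpn)
  have h1 : 2 ^ (p - 1) ≤ (a - 1) ^ n.totient :=
    (Nat.pow_le_pow_left (by omega) _).trans (Nat.pow_le_pow_right (by omega) htot)
  have h2 : p - 1 < 2 ^ (p - 1) := Nat.lt_two_pow_self
  omega

theorem stmt_15 (n : ℕ) (hn : 5 ≤ n) :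
    ∃ s : ℕ, s.Prime ∧ 19 < s ∧ s ∣ 13 ^ n - 1 ∧
      ∀ i : ℕ, 1 ≤ i → i < n → ¬ s ∣ 13 ^ i - 1 := by
  by_cases h10 : n = 10
  · subst h10
    refine ⟨2411, by norm_num, by norm_num, by norm_num, fun i h1 h2 => ?_⟩
    interval_cases i <;> norm_num
  by_cases h18 : n = 18
  · subst h18
    refine ⟨271, by norm_num, by norm_num, by norm_num, fun i h1 h2 => ?_⟩
    interval_cases i <;> norm_num
  obtain ⟨p, hp, ho⟩ := exists_prime_orderOf_eq (a := 13) (n := n) (by norm_num) (by omega)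
  have hdvd : ∀ i : ℕ, p ∣ 13 ^ i - 1 ↔ n ∣ i := by
    intro i
    rw [← ho, orderOf_dvd_iff_pow_eq_one, ← Nat.modEq_iff_dvd' (Nat.one_le_pow _ _ (by norm_num)),
      ← ZMod.natCast_eq_natCast_iff]
    push_cast
    exact eq_comm
  refine ⟨p, hp, ?_, (hdvd n).2 dvd_rfl, fun i h1 h2 h =>
    absurd (Nat.le_of_dvd h1 ((hdvd i).1 h)) (by omega)⟩
  by_contra! hle
  have hp13 : p ≠ 13 := by
    rintro rfl
    have h1 : 13 ∣ 13 ^ n - 1 := (hdvd n).2 dvd_rfl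
    have h2 : 13 ∣ 13 ^ n := dvd_pow_self 13 (by omega)
    have h3 : 0 < 13 ^ n := by positivity
    omega
  have hcases : p ∣ 13 ^ 4 - 1 ∨ p = 11 ∨ p = 19 := by
    interval_cases p <;> revert hp hp13 <;> norm_num
  rcases hcases with h | rfl | rfl
  · have := Nat.le_of_dvd (by norm_num) ((hdvd 4).1 h)
    omega
  · have hn10 : n ∣ 10 := (hdvd 10).1 (by norm_num)
    have hn5 : ¬ n ∣ 5 := (hdvd 5).not.1 (by norm_num)
    have := Nat.le_of_dvd (by norm_num) hn10
    interval_cases n <;> omega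
  · have hn18 : n ∣ 18 := (hdvd 18).1 (by norm_num)
    have hn6 : ¬ n ∣ 6 := (hdvd 6).not.1 (by norm_num)
    have hn9 : ¬ n ∣ 9 := (hdvd 9).not.1 (by norm_num)
    have := Nat.le_of_dvd (by norm_num) hn18
    interval_cases n <;> omega
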